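/- Fix c with 0 < c < 1 and let ε_bsc ∈ (0,1/2) solve 1 - h₂(ε_bsc) = c. For x ∈ [1-2ε_bsc, 1), set z(x) = (log₂(1-x) + log₂(1+x)) / (log₂(1-x) - log₂(1+x)) and γ(x) = (1 - c - h(x))/(1 - h(x)). Then γ(x) ∈ [0,1], the measure ν = γ(x)·δ₀ + (1-γ(x))·δ_x belongs to BMS(c) with Λ_ν(z(x)) = γ(x)·(1-z(x)) + (1-γ(x))·(1-x), and for every μ ∈ BMS(c), Λ_μ(z(x)) ≥ γ(x)·(1-z(x)) + (1-γ(x))·(1-x); that is, the infimum over BMS(c) of Λ_·(z(x)) equals γ(x)·(1-z(x)) + (1-γ(x))·(1-x) and is attained by ν. -/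

import Mathlib

open MeasureTheory Real Set

/-- Binary entropy function (Lean's `logb` satisfies `logb 2 0 = 0`,
so the convention `0·log₂ 0 = 0` is automatic). -/
noncomputable def h2 (p : ℝ) : ℝ := -p * Real.logb 2 p - (1 - p) * Real.logb 2 (1 - p)

/-- `h(x) = h₂((1-x)/2)`. -/
noncomputable def hD (x : ℝ) : ℝ := h2 ((1 - x) / 2)

/-- `Λ_μ(z) = ∫ (1 - max(z,x)) dμ(x)`. -/
noncomputable def Lam (μ : Measure ℝ) (z : ℝ) : ℝ := ∫ x, (1 - max z x) ∂μ

lemma h2_eq_binEntropy (p : ℝ) : h2 p = Real.binEntropy p / Real.log 2 := by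
  simp only [h2, Real.binEntropy_eq_negMulLog_add_negMulLog_one_sub, Real.negMulLog, Real.logb]
  ring

lemma continuous_hD : Continuous hD := by
  have : hD = fun y => Real.binEntropy ((1 - y) / 2) / Real.log 2 :=
    funext fun y => h2_eq_binEntropy _
  rw [this]
  fun_prop

lemma mul_log_sub_log_le {p q : ℝ} (hp : 0 ≤ p) (hq : 0 < q) :
    p * (Real.log q - Real.log p) ≤ q - p := by
  rcases hp.eq_or_lt with rfl | hp
  · simpa using hq.le
  · rw [← Real.log_div hq.ne' hp.ne']
    calc p * Real.log (q / p) ≤ p * (q / p - 1) :=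
          mul_le_mul_of_nonneg_left (Real.log_le_sub_one_of_pos (div_pos hq hp)) hp.le
      _ = q - p := by field_simp

/-- Gibbs' inequality for two-point distributions. -/
lemma h2_le_crossEntropy {p q : ℝ} (hp0 : 0 ≤ p) (hp1 : p ≤ 1) (hq0 : 0 < q) (hq1 : q < 1) :
    h2 p ≤ -p * Real.logb 2 q - (1 - p) * Real.logb 2 (1 - q) := by
  have h1 := mul_log_sub_log_le hp0 hq0
  have h3 := mul_log_sub_log_le (sub_nonneg.2 hp1) (sub_pos.2 hq1)
  have hl : 0 < Real.log 2 := Real.log_pos (by norm_num)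
  have e1 : h2 p = (-p * Real.log p - (1 - p) * Real.log (1 - p)) / Real.log 2 := by
    simp only [h2, Real.logb]; ring
  have e2 : -p * Real.logb 2 q - (1 - p) * Real.logb 2 (1 - q) =
      (-p * Real.log q - (1 - p) * Real.log (1 - q)) / Real.log 2 := by
    simp only [Real.logb]; ring
  rw [e1, e2]
  gcongr ?_ / _
  linarith

lemma logb_two_half {t : ℝ} (ht : 0 < t) : Real.logb 2 (t / 2) = Real.logb 2 t - 1 := by
  rw [Real.logb_div ht.ne' two_ne_zero, Real.logb_self_eq_one one_lt_two]

lemma hD_eq {x : ℝ} (h0 : 0 < 1 - x) (h1 : 0 < 1 + x) :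
    hD x = 1 - ((1 - x) * Real.logb 2 (1 - x) + (1 + x) * Real.logb 2 (1 + x)) / 2 := by
  have e : 1 - (1 - x) / 2 = (1 + x) / 2 := by ring
  rw [hD, h2, e, logb_two_half h0, logb_two_half h1]
  ring

/-- The graph of `hD` lies below its tangent lines. -/
lemma hD_le_tangent {x y : ℝ} (h0 : 0 < 1 - x) (h1 : 0 < 1 + x) (hy : y ∈ Set.Icc (0 : ℝ) 1) :
    hD y ≤ 1 - ((1 - y) * Real.logb 2 (1 - x) + (1 + y) * Real.logb 2 (1 + x)) / 2 := by
  have e : 1 - (1 - x) / 2 = (1 + x) / 2 := by ring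
  have := h2_le_crossEntropy (p := (1 - y) / 2) (q := (1 - x) / 2)
    (by linarith [hy.2]) (by linarith [hy.1]) (by linarith) (by linarith)
  rw [e, logb_two_half h0, logb_two_half h1] at this
  rw [hD]
  linarith

lemma hD_le_one {y : ℝ} (hy : y ∈ Set.Icc (0 : ℝ) 1) : hD y ≤ 1 := by
  simpa using hD_le_tangent (x := 0) (by norm_num) (by norm_num) hy

lemma hD_zero : hD 0 = 1 := by
  simpa using hD_eq (x := 0) (by norm_num) (by norm_num)

lemma hD_le_of_le {ε x : ℝ} (hε : ε < 1 / 2) (hx : 1 - 2 * ε ≤ x) (hx1 : x < 1) :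
    hD x ≤ h2 ε := by
  have hl : 0 < Real.log 2 := Real.log_pos (by norm_num)
  rw [hD, h2_eq_binEntropy, h2_eq_binEntropy]
  gcongr ?_ / _
  refine Real.binEntropy_strictMonoOn.monotoneOn ⟨?_, ?_⟩ ⟨?_, ?_⟩ ?_ <;>
    norm_num at * <;> linarith

lemma integrable_of_continuous_of_Icc {μ : Measure ℝ} [IsProbabilityMeasure μ]
    (hμ : μ (Set.Icc (0 : ℝ) 1)ᶜ = 0) {f : ℝ → ℝ} (hf : Continuous f) : Integrable f μ := by
  have : μ.restrict (Set.Icc (0 : ℝ) 1) = μ := Measure.restrict_eq_self_of_ae_mem hμ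
  rw [← this]
  exact hf.continuousOn.integrableOn_compact isCompact_Icc

lemma integral_two_dirac {γ x : ℝ} (h0 : 0 ≤ γ) (h1 : γ ≤ 1) (f : ℝ → ℝ) :
    ∫ y, f y ∂(ENNReal.ofReal γ • Measure.dirac (0 : ℝ) +
      ENNReal.ofReal (1 - γ) • Measure.dirac x) = γ * f 0 + (1 - γ) * f x := by
  rw [integral_add_measure ((integrable_dirac enorm_lt_top).smul_measure ENNReal.ofReal_ne_top)
    ((integrable_dirac enorm_lt_top).smul_measure ENNReal.ofReal_ne_top)]
  simp [integral_smul_measure, integral_dirac, h0, h1]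

/-- For `x ∈ [1-2ε_bsc, 1)`, setting
`z(x) = (log₂(1-x)+log₂(1+x))/(log₂(1-x)-log₂(1+x))` and
`γ(x) = (1-c-h(x))/(1-h(x))`, the two-mass measure
`ν = γ(x)·δ₀ + (1-γ(x))·δ_x` belongs to `BMS(c)` and attains the infimum of
`Λ_·(z(x))` over `BMS(c)`, which equals `γ(x)·(1-z(x)) + (1-γ(x))·(1-x)`. -/
theorem Lam_min_above_zbsc
    (c ε : ℝ) (hc0 : 0 < c) (hc1 : c < 1)
    (hε0 : 0 < ε) (hε1 : ε < 1 / 2) (hεc : 1 - h2 ε = c)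
    (x : ℝ) (hx_lb : 1 - 2 * ε ≤ x) (hx1 : x < 1) :
    (0 ≤ (1 - c - hD x) / (1 - hD x) ∧ (1 - c - hD x) / (1 - hD x) ≤ 1) ∧
      IsProbabilityMeasure
        (ENNReal.ofReal ((1 - c - hD x) / (1 - hD x)) • Measure.dirac (0:ℝ) +
          ENNReal.ofReal (1 - (1 - c - hD x) / (1 - hD x)) • Measure.dirac x) ∧
      (ENNReal.ofReal ((1 - c - hD x) / (1 - hD x)) • Measure.dirac (0:ℝ) +
          ENNReal.ofReal (1 - (1 - c - hD x) / (1 - hD x)) • Measure.dirac x)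
        (Set.Icc (0:ℝ) 1)ᶜ = 0 ∧
      (∫ y, hD y
          ∂(ENNReal.ofReal ((1 - c - hD x) / (1 - hD x)) • Measure.dirac (0:ℝ) +
            ENNReal.ofReal (1 - (1 - c - hD x) / (1 - hD x)) • Measure.dirac x)) =
        1 - c ∧
      Lam (ENNReal.ofReal ((1 - c - hD x) / (1 - hD x)) • Measure.dirac (0:ℝ) +
            ENNReal.ofReal (1 - (1 - c - hD x) / (1 - hD x)) • Measure.dirac x)
          ((Real.logb 2 (1 - x) + Real.logb 2 (1 + x)) /
            (Real.logb 2 (1 - x) - Real.logb 2 (1 + x))) =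
        ((1 - c - hD x) / (1 - hD x)) *
            (1 - (Real.logb 2 (1 - x) + Real.logb 2 (1 + x)) /
              (Real.logb 2 (1 - x) - Real.logb 2 (1 + x))) +
          (1 - (1 - c - hD x) / (1 - hD x)) * (1 - x) ∧
      ∀ μ : Measure ℝ, IsProbabilityMeasure μ → μ (Set.Icc (0:ℝ) 1)ᶜ = 0 →
        (∫ y, hD y ∂μ) = 1 - c →
        ((1 - c - hD x) / (1 - hD x)) *
              (1 - (Real.logb 2 (1 - x) + Real.logb 2 (1 + x)) /
                (Real.logb 2 (1 - x) - Real.logb 2 (1 + x))) +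
            (1 - (1 - c - hD x) / (1 - hD x)) * (1 - x) ≤
          Lam μ ((Real.logb 2 (1 - x) + Real.logb 2 (1 + x)) /
            (Real.logb 2 (1 - x) - Real.logb 2 (1 + x))) := by
  have hx0 : 0 < x := by linarith
  have ha0 : 0 < 1 - x := by linarith
  have hb0 : 0 < 1 + x := by linarith
  have hhx : hD x ≤ 1 - c := by
    have := hD_le_of_le hε1 hx_lb hx1
    linarith
  have hpos : 0 < 1 - hD x := by linarith
  have hA : Real.logb 2 (1 - x) < 0 := Real.logb_neg one_lt_two ha0 (by linarith)
  have hB : 0 < Real.logb 2 (1 + x) := Real.logb_pos one_lt_two (by linarith)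
  have hAB : Real.logb 2 (1 - x) + Real.logb 2 (1 + x) ≤ 0 := by
    rw [← Real.logb_mul ha0.ne' hb0.ne']
    exact Real.logb_nonpos one_lt_two (by positivity) (by nlinarith)
  have hDx := hD_eq ha0 hb0
  have htan := fun y => hD_le_tangent (y := y) ha0 hb0
  set A := Real.logb 2 (1 - x)
  set B := Real.logb 2 (1 + x)
  set H := hD x with hH
  set γ := (1 - c - H) / (1 - H) with hγ
  set z := (A + B) / (A - B) with hz
  have hBA : 0 < B - A := by linarith
  have hγ0 : 0 ≤ γ := div_nonneg (by linarith) hpos.le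
  have hγ1 : γ ≤ 1 := (div_le_one hpos).2 (by linarith)
  have hγe : γ + (1 - γ) * H = 1 - c := by
    have : γ * (1 - H) = 1 - c - H := div_mul_cancel₀ _ hpos.ne'
    linarith
  have hz0 : 0 ≤ z := div_nonneg_of_nonpos hAB (by linarith)
  have hze : z * (B - A) = -(A + B) := by
    have : z * (A - B) = A + B := div_mul_cancel₀ _ (by linarith)
    linarith
  have hxz : (x - z) * (B - A) = 2 * (1 - H) := by linarith
  have hzx : z ≤ x := by
    by_contra hlt
    nlinarith
  refine ⟨⟨hγ0, hγ1⟩, ⟨?_⟩, ?_, ?_, ?_, ?_⟩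
  · simp [← ENNReal.ofReal_add hγ0 (sub_nonneg.2 hγ1)]
  · simp [hx0.le, hx1.le]
  · rw [integral_two_dirac hγ0 hγ1, hD_zero, ← hH]
    linarith
  · rw [Lam, integral_two_dirac hγ0 hγ1, max_eq_left hz0, max_eq_right hzx]
  · intro μ _ hμ hint
    have hβ : 2 / (B - A) * (1 - H) = x - z := by
      field_simp
      linarith
    set β := 2 / (B - A) with hβd
    have hβ0 : 0 < β := by positivity
    have hβB : β * (B - A) = 2 := div_mul_cancel₀ _ hBA.ne'
    have hpt : ∀ y ∈ Set.Icc (0 : ℝ) 1, 1 - z - β + β * hD y ≤ 1 - max z y := by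
      intro y hy
      rcases max_cases z y with ⟨h, _⟩ | ⟨h, _⟩ <;> rw [h]
      · nlinarith [hD_le_one hy]
      · have h1 := mul_le_mul_of_nonneg_left (htan y hy) hβ0.le
        have hzβ : z * (β * (B - A)) = -(β * (A + B)) := by linear_combination β * hze
        rw [hβB] at hzβ
        linear_combination h1 - hzβ / 2 - y / 2 * hβB
    have hi1 := (integrable_of_continuous_of_Icc hμ continuous_hD).const_mul β
    calc γ * (1 - z) + (1 - γ) * (1 - x) = 1 - z - β + β * (1 - c) := by
          linear_combination (1 - γ) * hβ + β * hγe
      _ = ∫ y, (1 - z - β + β * hD y) ∂μ := by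
          rw [integral_add (integrable_const _) hi1, integral_const_mul, hint]
          simp
      _ ≤ Lam μ z := by
          refine integral_mono_ae ((integrable_const _).add hi1)
            (integrable_of_continuous_of_Icc hμ (by fun_prop)) ?_
          filter_upwards [show ∀ᵐ y ∂μ, y ∈ Set.Icc (0 : ℝ) 1 from hμ] using hpt
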